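/- Let λ, μ, ν be partitions with at most k parts such that |ν| = |λ| + |μ|, let σ, τ be permutations of {1,…,k}, and let r(t) = t(σ(λ) + τ(μ) − ν) + (σ(δ) + τ(δ) − 2δ), where δ = (1/2)(k−1, k−3, …, −(k−1)) and permutations act on vectors by permuting coordinates. Then there exists an integer N such that the function t ↦ K(r(t)) agrees, for all integers t ≥ N, with a polynomial in t of degree at most (k−1 choose 2). -/

import Mathlib

/-!
STATEMENT 7: Let λ, μ, ν be partitions with at most k parts such that |ν| = |λ| + |μ|,
let σ, τ be permutations of {1,…,k}, and let
r(t) = t(σ(λ) + τ(μ) − ν) + (σ(δ) + τ(δ) − 2δ),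
where δ = (1/2)(k−1, k−3, …, −(k−1)) and permutations act on vectors by permuting
coordinates.  Then there exists an integer N such that the function t ↦ K(r(t)) agrees,
for all integers t ≥ N, with a polynomial in t of degree at most (k−1 choose 2).

Partitions with at most k parts are encoded as antitone functions `Fin k → ℕ`.
-/

/-- The Kostant partition function for the root system of type `A_{k-1}`: `kostant k v` is
the number of ways to write `v` as a nonnegative integer combination of the positive roots
`e_i - e_j`, `i < j` (and it is `0` if `v` is not an integer vector).  A combination is
recorded as a matrix `b` of nonnegative integers supported on pairs `(i, j)` with `i < j`;
the coordinate `i` of `Σ_{i<j} b_{ij} (e_i - e_j)` is `Σ_j b_{ij} - Σ_j b_{ji}`. -/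
noncomputable def kostant (k : ℕ) (v : Fin k → ℚ) : ℕ :=
  Nat.card {b : Fin k × Fin k → ℕ //
    (∀ p : Fin k × Fin k, ¬ p.1 < p.2 → b p = 0) ∧
    ∀ i : Fin k, (∑ j : Fin k, (b (i, j) : ℚ)) - (∑ j : Fin k, (b (j, i) : ℚ)) = v i}

/-- The half-sum of positive roots `δ = (1/2)(k-1, k-3, …, -(k-3), -(k-1))`. -/
noncomputable def halfδ (k : ℕ) : Fin k → ℚ := fun i => ((k : ℚ) - 1) / 2 - (i : ℕ)

open Polynomial in
theorem Polynomial.natDegree_bernoulli_le (n : ℕ) : (Polynomial.bernoulli n).natDegree ≤ n := by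
  rw [natDegree_le_iff_coeff_eq_zero]
  intro m hm
  rw [coeff_bernoulli, if_neg (by omega)]

/-- Every polynomial of degree at most `d` has a discrete antiderivative of degree at most
`d + 1`. -/
theorem Polynomial.exists_eval_add_one_sub_eval (q : Polynomial ℚ) (d : ℕ)
    (hq : q.natDegree ≤ d) :
    ∃ P : Polynomial ℚ, P.natDegree ≤ d + 1 ∧
      ∀ x : ℚ, P.eval (x + 1) - P.eval x = q.eval x := by
  refine ⟨∑ n ∈ Finset.range (d + 1),
    C (q.coeff n / (n + 1)) * Polynomial.bernoulli (n + 1), ?_, fun x => ?_⟩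
  · refine natDegree_sum_le_of_forall_le _ _ fun n hn => ?_
    refine (natDegree_C_mul_le _ _).trans ((natDegree_bernoulli_le _).trans ?_)
    simpa [Nat.lt_succ_iff] using hn
  · rw [eval_eq_sum_range' (Nat.lt_succ_of_le hq), eval_finsetSum, eval_finsetSum,
      ← Finset.sum_sub_distrib]
    refine Finset.sum_congr rfl fun n _ => ?_
    have h : (n : ℚ) + 1 ≠ 0 := by positivity
    simp only [eval_mul, eval_C]
    rw [add_comm x 1, bernoulli_eval_one_add, Nat.add_sub_cancel]
    push_cast
    field_simp
    ring

/-- `f` agrees with a polynomial of degree at most `d` at all sufficiently large integers. -/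
def EventuallyPolynomial (d : ℕ) (f : ℤ → ℚ) : Prop :=
  ∃ (N : ℤ) (p : Polynomial ℚ), p.natDegree ≤ d ∧ ∀ t : ℤ, N ≤ t → f t = p.eval (t : ℚ)

namespace EventuallyPolynomial

variable {d : ℕ} {f g : ℤ → ℚ}

theorem congr (hf : EventuallyPolynomial d f) (N : ℤ) (h : ∀ t, N ≤ t → g t = f t) :
    EventuallyPolynomial d g := by
  obtain ⟨M, p, hp, hM⟩ := hf
  exact ⟨max N M, p, hp, fun t ht => by
    rw [h t (le_trans (le_max_left _ _) ht), hM t (le_trans (le_max_right _ _) ht)]⟩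

theorem const (d : ℕ) (c : ℚ) : EventuallyPolynomial d fun _ => c :=
  ⟨0, Polynomial.C c, by simp, by simp⟩

theorem add (hf : EventuallyPolynomial d f) (hg : EventuallyPolynomial d g) :
    EventuallyPolynomial d fun t => f t + g t := by
  obtain ⟨M, p, hp, hM⟩ := hf
  obtain ⟨N, q, hq, hN⟩ := hg
  exact ⟨max M N, p + q, Polynomial.natDegree_add_le_of_degree_le hp hq, fun t ht => by
    simp only [hM t (le_trans (le_max_left _ _) ht), hN t (le_trans (le_max_right _ _) ht),
      Polynomial.eval_add]⟩

theorem neg (hf : EventuallyPolynomial d f) : EventuallyPolynomial d fun t => -f t := by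
  obtain ⟨M, p, hp, hM⟩ := hf
  exact ⟨M, -p, by simpa using hp, fun t ht => by simp [hM t ht]⟩

theorem of_add_one_sub (hf : EventuallyPolynomial d fun t => f (t + 1) - f t) :
    EventuallyPolynomial (d + 1) f := by
  obtain ⟨N, q, hq, hN⟩ := hf
  obtain ⟨P, hP, hPq⟩ := q.exists_eval_add_one_sub_eval d hq
  refine ⟨N, P + Polynomial.C (f N - P.eval (N : ℚ)),
    Polynomial.natDegree_add_le_of_degree_le hP (by simp), fun t ht => ?_⟩
  induction t, ht using Int.leInduction with
  | base => simp
  | succ t ht ih =>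
    have h₁ := hN t ht
    have h₂ := hPq t
    simp only [Polynomial.eval_add, Polynomial.eval_C] at ih ⊢
    push_cast
    linarith

end EventuallyPolynomial

section VectorPartition

variable {ι V : Type*} [Fintype ι] [DecidableEq ι] [AddCommGroup V]

/-- The ways to write `v` as a nonnegative integer combination of the vectors `w p`, `p ∈ S`. -/
def vectorPartitions (w : ι → V) (S : Finset ι) (v : V) : Set (ι → ℕ) :=
  {f | (∀ p, p ∉ S → f p = 0) ∧ ∑ p, f p • w p = v}

variable {w : ι → V} {S : Finset ι} {v : V}

theorem sum_smul_mem_span {f : ι → ℕ} (hf : ∀ p, p ∉ S → f p = 0) :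
    ∑ p, f p • w p ∈ Submodule.span ℤ (w '' S) := by
  refine Submodule.sum_mem _ fun p _ => ?_
  by_cases hp : p ∈ S
  · exact Submodule.smul_of_tower_mem _ _ (Submodule.subset_span ⟨p, hp, rfl⟩)
  · simp [hf p hp]

theorem mem_span_of_ncard_ne_zero (h : (vectorPartitions w S v).ncard ≠ 0) :
    v ∈ Submodule.span ℤ (w '' S) := by
  obtain ⟨f, hf, rfl⟩ := Set.nonempty_of_ncard_ne_zero h
  exact sum_smul_mem_span hf

theorem vectorPartitions_finite (h : V →+ ℤ) (hS : ∀ p ∈ S, 0 < h (w p)) (v : V) :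
    (vectorPartitions w S v).Finite := by
  refine (Set.finite_Iic (fun _ : ι => (h v).toNat)).subset ?_
  rintro f ⟨hf, rfl⟩ p
  by_cases hp : p ∈ S
  · have h₁ : (f p : ℤ) * h (w p) ≤ ∑ q, (f q : ℤ) * h (w q) := by
      refine Finset.single_le_sum (f := fun q => (f q : ℤ) * h (w q)) (fun q _ => ?_)
        (Finset.mem_univ p)
      by_cases hq : q ∈ S
      · exact mul_nonneg (by positivity) (hS q hq).le
      · simp [hf q hq]
    have h₂ : (f p : ℤ) ≤ f p * h (w p) := le_mul_of_one_le_right (by positivity) (hS p hp)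
    have h₃ : h (∑ q, f q • w q) = ∑ q, (f q : ℤ) * h (w q) := by simp [map_sum]
    simp only [h₃]
    omega
  · simp [hf p hp]

theorem ncard_vectorPartitions_insert (h : V →+ ℤ) {p : ι} (hp : p ∉ S)
    (hS : ∀ q ∈ insert p S, 0 < h (w q)) (v : V) :
    (vectorPartitions w (insert p S) v).ncard =
      (vectorPartitions w S v).ncard + (vectorPartitions w (insert p S) (v - w p)).ncard := by
  have hinj : Function.Injective fun g : ι → ℕ => g + Pi.single p 1 :=
    add_left_injective _
  have hsum (g : ι → ℕ) : ∑ q, (g + Pi.single p 1 : ι → ℕ) q • w q = ∑ q, g q • w q + w p := by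
    simp [add_smul, Finset.sum_add_distrib, Pi.single_apply, ite_smul]
  have hunion : vectorPartitions w (insert p S) v = vectorPartitions w S v ∪
      (fun g : ι → ℕ => g + Pi.single p 1) '' vectorPartitions w (insert p S) (v - w p) := by
    ext f
    constructor
    · rintro ⟨hf, rfl⟩
      by_cases hfp : f p = 0
      · refine Or.inl ⟨fun q hq => ?_, rfl⟩
        by_cases hqp : q = p
        · rw [hqp, hfp]
        · exact hf q (by simp [hq, hqp])
      · have hfg : f = (f - Pi.single p 1) + Pi.single p 1 := by
          ext q
          by_cases hqp : q = p
          · subst hqp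
            simp
            omega
          · simp [hqp]
        refine Or.inr ⟨f - Pi.single p 1, ⟨fun q hq => by simp [hf q hq], ?_⟩, hfg.symm⟩
        conv_rhs => rw [hfg, hsum]
        simp
    · rintro (⟨hf, rfl⟩ | ⟨g, ⟨hg, hgv⟩, rfl⟩)
      · exact ⟨fun q hq => hf q fun hqS => hq (Finset.mem_insert_of_mem hqS), rfl⟩
      · refine ⟨fun q hq => ?_, ?_⟩
        · have : q ≠ p := fun h => hq (h ▸ Finset.mem_insert_self _ _)
          simp [hg q hq, this]
        · rw [hsum, hgv, sub_add_cancel]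
  have hdisj : Disjoint (vectorPartitions w S v)
      ((fun g : ι → ℕ => g + Pi.single p 1) ''
        vectorPartitions w (insert p S) (v - w p)) := by
    rw [Set.disjoint_left]
    rintro _ ⟨hf, -⟩ ⟨g, -, rfl⟩
    simpa using hf p hp
  rw [hunion, Set.ncard_union_eq hdisj
    (vectorPartitions_finite h (fun q hq => hS q (Finset.mem_insert_of_mem hq)) v)
    ((vectorPartitions_finite h hS _).image _), Set.ncard_image_of_injective _ hinj]

theorem eventuallyPolynomial_sub_of_mem_span {d : ℕ} {a : V} (h : V →+ ℤ)
    (hS : ∀ p ∈ S, 0 < h (w p))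
    (ih : ∀ p ∈ S, ∀ b, EventuallyPolynomial d
      fun t => ((vectorPartitions w (S.erase p) (t • a + b)).ncard : ℚ))
    {u : V} (hu : u ∈ Submodule.span ℤ (w '' S)) (b : V) :
    EventuallyPolynomial d fun t => ((vectorPartitions w S (t • a + (b + u))).ncard : ℚ) -
      (vectorPartitions w S (t • a + b)).ncard := by
  rw [← Submodule.mem_toAddSubgroup, Submodule.span_int_eq_addSubgroupClosure] at hu
  induction hu using AddSubgroup.closure_induction generalizing b with
  | mem x hx =>
    obtain ⟨p, hp, rfl⟩ := hx
    refine (ih p hp (b + w p)).congr 0 fun t _ => ?_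
    have key := ncard_vectorPartitions_insert (w := w) h (Finset.notMem_erase p S)
      (by rwa [Finset.insert_erase hp]) (t • a + (b + w p))
    rw [Finset.insert_erase hp, ← add_assoc, add_sub_cancel_right] at key
    rw [← add_assoc, key]
    push_cast
    ring
  | zero => exact (EventuallyPolynomial.const d 0).congr 0 fun t _ => by simp
  | add x y _ _ hx hy =>
    refine ((hx b).add (hy (b + x))).congr 0 fun t _ => ?_
    rw [add_assoc b x y]
    ring
  | neg x _ hx =>
    refine (hx (b + -x)).neg.congr 0 fun t _ => ?_
    rw [neg_add_cancel_right]
    ring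

/-- If no nonzero multiple of `w p` lies in the span of `S`, the coefficient of `w p` in a
representation is forced. -/
theorem ncard_vectorPartitions_insert_smul (h : V →+ ℤ) {p : ι} (hp : p ∉ S)
    (hS : ∀ q ∈ insert p S, 0 < h (w q))
    (hwp : ∀ n : ℤ, n ≠ 0 → n • w p ∉ Submodule.span ℤ (w '' S))
    (hv : v ∈ Submodule.span ℤ (w '' S)) (m : ℤ) :
    (vectorPartitions w (insert p S) (m • w p + v)).ncard =
      if 0 ≤ m then (vectorPartitions w S v).ncard else 0 := by
  have hneg (m : ℤ) (hm : m < 0) :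
      (vectorPartitions w (insert p S) (m • w p + v)).ncard = 0 := by
    rw [Set.ncard_eq_zero (vectorPartitions_finite h hS _), Set.eq_empty_iff_forall_notMem]
    rintro f ⟨hf, hfv⟩
    refine hwp ((f p : ℤ) - m) (by omega) ?_
    have hmem : ∑ q, Function.update f p 0 q • w q ∈ Submodule.span ℤ (w '' S) := by
      refine sum_smul_mem_span fun q hq => ?_
      by_cases hqp : q = p
      · simp [hqp]
      · simp [hqp, hf q (by simp [hq, hqp])]
    have hsum : ∑ q, f q • w q = f p • w p + ∑ q, Function.update f p 0 q • w q := by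
      rw [← Finset.add_sum_erase _ _ (Finset.mem_univ p),
        ← Finset.add_sum_erase _ (fun q => Function.update f p 0 q • w q) (Finset.mem_univ p)]
      simp only [Function.update_self, zero_smul, zero_add]
      congr 1
      refine Finset.sum_congr rfl fun q hq => ?_
      rw [Function.update_of_ne (Finset.ne_of_mem_erase hq)]
    have : ((f p : ℤ) - m) • w p = v - ∑ q, Function.update f p 0 q • w q := by
      rw [sub_smul, natCast_zsmul, eq_sub_of_add_eq (hsum.symm.trans hfv)]
      abel
    rw [this]
    exact Submodule.sub_mem _ hv hmem
  split_ifs with hm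
  · induction m, hm using Int.leInduction with
    | base =>
      rw [ncard_vectorPartitions_insert h hp hS, zero_smul, zero_add]
      have := hneg (-1) (by norm_num)
      rw [neg_one_smul, neg_add_eq_sub] at this
      rw [this, add_zero]
    | succ m hm ih =>
      rw [ncard_vectorPartitions_insert h hp hS]
      have h₁ : (m + 1) • w p + v - w p = m • w p + v := by
        rw [add_smul, one_smul]
        abel
      have h₂ : (vectorPartitions w S ((m + 1) • w p + v)).ncard = 0 := by
        by_contra hne
        exact hwp (m + 1) (by omega)
          ((Submodule.add_mem_iff_left _ hv).1 (mem_span_of_ncard_ne_zero hne))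
      rw [h₁, h₂, ih, zero_add]
  · exact hneg m (not_le.1 hm)

theorem finrank_sup_span_singleton_le [Module.Finite ℤ V] (x : V) (A : Submodule ℤ V) :
    Module.finrank ℤ ↥(Submodule.span ℤ {x} ⊔ A) ≤ Module.finrank ℤ A + 1 := by
  have h₁ := Submodule.rank_add_le_rank_add_rank (Submodule.span ℤ {x}) A
  have h₂ := rank_span_le (R := ℤ) ({x} : Set V)
  rw [Cardinal.mk_singleton] at h₂
  rw [← Nat.cast_le (α := Cardinal), Nat.cast_add, Module.finrank_eq_rank,
    Module.finrank_eq_rank, Nat.cast_one, add_comm]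
  exact h₁.trans (by gcongr)

/-- The vector partition function of a family whose subfamilies all have saturated span is
eventually polynomial along every ray. -/
theorem eventuallyPolynomial_ncard_vectorPartitions [Module.Finite ℤ V] (h : V →+ ℤ)
    (hS : ∀ p ∈ S, 0 < h (w p))
    (hsat : ∀ T ⊆ S, ∀ (n : ℤ) (v : V), n ≠ 0 →
      n • v ∈ Submodule.span ℤ (w '' T) → v ∈ Submodule.span ℤ (w '' T))
    {d : ℕ} (hd : S.card ≤ d + Module.finrank ℤ (Submodule.span ℤ (w '' S))) (a b : V) :
    EventuallyPolynomial d fun t => ((vectorPartitions w S (t • a + b)).ncard : ℚ) := by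
  induction S using Finset.strongInduction generalizing d a b with
  | H S ih =>
  by_cases ha : a ∈ Submodule.span ℤ (w '' S)
  swap
  · by_cases hex : ∃ t₀ : ℤ, t₀ • a + b ∈ Submodule.span ℤ (w '' S)
    · obtain ⟨t₀, ht₀⟩ := hex
      refine (EventuallyPolynomial.const d 0).congr (t₀ + 1) fun t ht => ?_
      rw [Nat.cast_eq_zero]
      by_contra hne
      refine ha (hsat S subset_rfl (t - t₀) a (by omega) ?_)
      have := Submodule.sub_mem _ (mem_span_of_ncard_ne_zero hne) ht₀
      rwa [add_sub_add_right_eq_sub, ← sub_smul] at this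
    · refine (EventuallyPolynomial.const d 0).congr 0 fun t ht => ?_
      rw [Nat.cast_eq_zero]
      by_contra hne
      exact hex ⟨t, mem_span_of_ncard_ne_zero hne⟩
  have ih' (p) (hp : p ∈ S) {e : ℕ} (he : (S.erase p).card ≤
      e + Module.finrank ℤ (Submodule.span ℤ (w '' (S.erase p : Finset ι)))) (a b : V) :
      EventuallyPolynomial e
        fun t => ((vectorPartitions w (S.erase p) (t • a + b)).ncard : ℚ) :=
    ih _ (Finset.erase_ssubset hp) (fun q hq => hS q (Finset.mem_of_mem_erase hq))
      (fun T hT => hsat T (hT.trans (Finset.erase_subset p S))) he a b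
  have himage (p) (hp : p ∈ S) : w '' S = insert (w p) (w '' (S.erase p : Finset ι)) := by
    rw [← Set.image_insert_eq, ← Finset.coe_insert, Finset.insert_erase hp]
  by_cases hcoloop : ∃ p ∈ S, w p ∉ Submodule.span ℤ (w '' (S.erase p : Finset ι))
  · obtain ⟨p, hp, hwp⟩ := hcoloop
    by_cases hb : b ∈ Submodule.span ℤ (w '' S)
    swap
    · refine (EventuallyPolynomial.const d 0).congr 0 fun t ht => ?_
      rw [Nat.cast_eq_zero]
      by_contra hne
      exact hb ((Submodule.add_mem_iff_right _ (Submodule.smul_mem _ t ha)).1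
        (mem_span_of_ncard_ne_zero hne))
    have he : (S.erase p).card ≤
        d + Module.finrank ℤ (Submodule.span ℤ (w '' (S.erase p : Finset ι))) := by
      rw [himage p hp, Submodule.span_insert] at hd
      have := finrank_sup_span_singleton_le (w p)
        (Submodule.span ℤ (w '' (S.erase p : Finset ι)))
      rw [Finset.card_erase_of_mem hp]
      omega
    rw [himage p hp, Submodule.mem_span_insert] at ha hb
    obtain ⟨m, a', ha', rfl⟩ := ha
    obtain ⟨n, b', hb', rfl⟩ := hb
    have key (t : ℤ) : (vectorPartitions w S (t • (m • w p + a') + (n • w p + b'))).ncard =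
        if 0 ≤ t * m + n then (vectorPartitions w (S.erase p) (t • a' + b')).ncard else 0 := by
      have := ncard_vectorPartitions_insert_smul (w := w) (S := S.erase p) h
        (Finset.notMem_erase p S) (by rwa [Finset.insert_erase hp])
        (fun n hn hmem => hwp (hsat _ (Finset.erase_subset p S) n _ hn hmem))
        (Submodule.add_mem _ (Submodule.smul_mem _ t ha') hb') (t * m + n)
      rw [Finset.insert_erase hp] at this
      rw [← this]
      congr 2
      rw [smul_add, add_smul, mul_smul]
      abel
    have hsign : (∃ N : ℤ, ∀ t, N ≤ t → 0 ≤ t * m + n) ∨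
        ∃ N : ℤ, ∀ t, N ≤ t → ¬ 0 ≤ t * m + n := by
      rcases lt_trichotomy m 0 with hm | rfl | hm
      · exact Or.inr ⟨|n| + 1, fun t ht => by nlinarith [le_abs_self n, abs_nonneg n]⟩
      · by_cases hn : 0 ≤ n
        · exact Or.inl ⟨0, fun t _ => by simpa⟩
        · exact Or.inr ⟨0, fun t _ => by simpa using hn⟩
      · exact Or.inl ⟨|n|, fun t ht => by nlinarith [neg_abs_le n, abs_nonneg n]⟩
    rcases hsign with ⟨N, hN⟩ | ⟨N, hN⟩
    · exact (ih' p hp he a' b').congr N fun t ht => by rw [key, if_pos (hN t ht)]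
    · exact (EventuallyPolynomial.const d 0).congr N fun t ht => by
        rw [key, if_neg (hN t ht), Nat.cast_zero]
  · push Not at hcoloop
    rcases S.eq_empty_or_nonempty with rfl | ⟨p₀, hp₀⟩
    · obtain rfl : a = 0 := by simpa using ha
      simpa using EventuallyPolynomial.const d _
    have hspan (p) (hp : p ∈ S) : Submodule.span ℤ (w '' S) =
        Submodule.span ℤ (w '' (S.erase p : Finset ι)) := by
      rw [himage p hp, Submodule.span_insert_eq_span (hcoloop p hp)]
    classical
    have hrank : Module.finrank ℤ (Submodule.span ℤ (w '' S)) ≤ S.card - 1 := by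
      rw [hspan p₀ hp₀, ← Finset.card_erase_of_mem hp₀, ← Finset.coe_image]
      exact (finrank_span_finset_le_card _).trans Finset.card_image_le
    have hpos := Finset.card_pos.2 ⟨p₀, hp₀⟩
    obtain ⟨e, rfl⟩ : ∃ e, d = e + 1 := ⟨d - 1, by omega⟩
    refine EventuallyPolynomial.of_add_one_sub ?_
    refine (eventuallyPolynomial_sub_of_mem_span h hS (fun p hp => ih' p hp ?_ a) ha b).congr 0
      fun t _ => ?_
    · rw [← hspan p hp, Finset.card_erase_of_mem hp]
      omega
    · rw [add_smul, one_smul, add_assoc, add_comm a b]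

end VectorPartition

section TypeA

variable {k : ℕ}

/-- The vector `e_i - e_j`. -/
def basisDiff (p : Fin k × Fin k) : Fin k → ℤ := Pi.single p.1 1 - Pi.single p.2 1

/-- The integer span of any set of vectors `e_i - e_j` is saturated. -/
theorem mem_span_basisDiff_of_smul_mem (T : Set (Fin k × Fin k)) {n : ℤ} {v : Fin k → ℤ}
    (hn : n ≠ 0) (hv : n • v ∈ Submodule.span ℤ (basisDiff '' T)) :
    v ∈ Submodule.span ℤ (basisDiff '' T) := by
  set L := Submodule.span ℤ (basisDiff '' T)
  let rel : Setoid (Fin k) :=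
    { r := fun i j => basisDiff (i, j) ∈ L
      iseqv :=
        { refl := fun i => by simp [basisDiff]
          symm := fun {i j} hij => by simpa [basisDiff] using L.neg_mem hij
          trans := fun {i j l} hij hjl => by simpa [basisDiff] using L.add_mem hij hjl } }
  let rep : Fin k → Fin k := fun i => (Quotient.mk rel i).out
  let φ : (Fin k → ℤ) →ₗ[ℤ] (Fin k → ℤ) :=
    (Pi.basisFun ℤ (Fin k)).constr ℤ fun i => Pi.single (rep i) 1
  have hφ (i : Fin k) : φ (Pi.single i 1) = Pi.single (rep i) 1 := by
    rw [← Pi.basisFun_apply, Module.Basis.constr_basis]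
  have hsub (u : Fin k → ℤ) : φ u - u ∈ L := by
    have hu : φ u - u = ∑ i, u i • basisDiff (rep i, i) := by
      conv_lhs => rw [← (Pi.basisFun ℤ (Fin k)).sum_repr u]
      simp only [Pi.basisFun_repr, Pi.basisFun_apply, map_sum, map_smul, hφ, basisDiff,
        smul_sub, Finset.sum_sub_distrib]
    rw [hu]
    exact L.sum_mem fun i _ => L.smul_mem _ (Quotient.mk_out (s := rel) i)
  have hker : L ≤ LinearMap.ker φ := by
    refine Submodule.span_le.2 ?_
    rintro _ ⟨⟨i, j⟩, hij, rfl⟩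
    have : rep i = rep j := congrArg Quotient.out
      (Quotient.sound (s := rel) (Submodule.subset_span ⟨(i, j), hij, rfl⟩))
    simp [basisDiff, hφ, this]
  have h₀ : φ v = 0 := by
    have : n • φ v = 0 := by rw [← map_smul]; exact hker hv
    exact (smul_eq_zero.1 this).resolve_left hn
  simpa [h₀] using hsub v

/-- The index set of the positive roots. -/
def positivePairs (k : ℕ) : Finset (Fin k × Fin k) :=
  Finset.univ.filter fun p => p.1 < p.2

theorem card_positivePairs (k : ℕ) : (positivePairs k).card = k.choose 2 := by
  have h : (positivePairs k).card = ∑ j : Fin k, (j : ℕ) := by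
    rw [positivePairs, Finset.card_filter, Fintype.sum_prod_type_right]
    refine Finset.sum_congr rfl fun j _ => ?_
    rw [← Finset.card_filter]
    simp [Finset.filter_gt_eq_Iio]
  rw [h, Fin.sum_univ_eq_sum_range (fun j => j) k, Finset.sum_range_id, Nat.choose_two_right]

theorem le_finrank_span_positivePairs (hk : 0 < k) :
    k ≤ Module.finrank ℤ
      (Submodule.span ℤ (basisDiff '' (positivePairs k : Set (Fin k × Fin k)))) + 1 := by
  set L := Submodule.span ℤ (basisDiff '' (positivePairs k : Set (Fin k × Fin k)))
  let o : Fin k := ⟨0, hk⟩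
  have htop : Submodule.span ℤ {(Pi.single o 1 : Fin k → ℤ)} ⊔ L = ⊤ := by
    rw [eq_top_iff, ← (Pi.basisFun ℤ (Fin k)).span_eq, Submodule.span_le]
    rintro _ ⟨j, rfl⟩
    rw [Pi.basisFun_apply]
    have ho : (Pi.single o 1 : Fin k → ℤ) ∈
        Submodule.span ℤ {(Pi.single o 1 : Fin k → ℤ)} ⊔ L :=
      Submodule.mem_sup_left (Submodule.mem_span_singleton_self _)
    by_cases hj : j = o
    · rwa [hj]
    · have hmem : basisDiff (o, j) ∈ L := by
        refine Submodule.subset_span ⟨(o, j), ?_, rfl⟩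
        have : (j : ℕ) ≠ 0 := fun h => hj (Fin.ext h)
        simp only [positivePairs, Finset.coe_filter, Finset.mem_univ, true_and,
          Set.mem_ofPred_eq, Fin.lt_def, o]
        omega
      simpa [basisDiff] using Submodule.sub_mem _ ho (Submodule.mem_sup_right hmem)
  have h := finrank_sup_span_singleton_le (Pi.single o 1 : Fin k → ℤ) L
  rwa [htop, finrank_top, Module.finrank_fin_fun] at h

theorem kostant_intCast (v : Fin k → ℤ) :
    kostant k (fun i => (v i : ℚ)) = (vectorPartitions basisDiff (positivePairs k) v).ncard := by
  rw [kostant, ← Nat.card_coe_set_eq]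
  congr 2
  ext f
  have hsum (i : Fin k) : (∑ p, f p • basisDiff p) i =
      ∑ j, (f (i, j) : ℤ) - ∑ j, (f (j, i) : ℤ) := by
    simp only [basisDiff, smul_sub, Finset.sum_sub_distrib, Pi.sub_apply, Finset.sum_apply,
      Pi.smul_apply, Pi.single_apply]
    congr 1
    · rw [Fintype.sum_prod_type_right]
      simp
    · rw [Fintype.sum_prod_type]
      simp
  simp only [vectorPartitions, positivePairs, Finset.mem_filter, Finset.mem_univ, true_and,
    Set.mem_ofPred_eq, funext_iff, hsum]
  refine and_congr_right fun _ => forall_congr' fun i => ?_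
  rw [← Int.cast_inj (α := ℚ)]
  push_cast
  rfl

/-- The pairing with `-(0, 1, …, k - 1)`, which is positive on positive roots. -/
def rootHeight (k : ℕ) : (Fin k → ℤ) →+ ℤ where
  toFun v := ∑ i : Fin k, -(i : ℤ) * v i
  map_zero' := by simp
  map_add' u v := by simp only [Pi.add_apply, mul_add, Finset.sum_add_distrib]

theorem rootHeight_basisDiff_pos (p : Fin k × Fin k) (hp : p ∈ positivePairs k) :
    0 < rootHeight k (basisDiff p) := by
  have hlt : (p.1 : ℕ) < p.2 := by simpa [positivePairs] using hp
  have h : rootHeight k (basisDiff p) = (p.2 : ℤ) - p.1 := by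
    simp [rootHeight, basisDiff, mul_sub, Pi.single_apply, Finset.sum_sub_distrib]
  omega

theorem eventuallyPolynomial_kostant (hk : 0 < k) (a b : Fin k → ℤ) :
    EventuallyPolynomial ((k - 1).choose 2)
      fun t => (kostant k (fun i => ((t • a + b) i : ℤ)) : ℚ) := by
  have hd : (positivePairs k).card ≤ (k - 1).choose 2 + Module.finrank ℤ
      (Submodule.span ℤ (basisDiff '' (positivePairs k : Set (Fin k × Fin k)))) := by
    have h := le_finrank_span_positivePairs hk
    obtain ⟨m, rfl⟩ : ∃ m, k = m + 1 := ⟨k - 1, by omega⟩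
    rw [card_positivePairs, Nat.choose_succ_succ', Nat.choose_one_right, Nat.add_sub_cancel,
      one_add_one_eq_two]
    omega
  have hsat (T) (_ : T ⊆ positivePairs k) (n : ℤ) (v : Fin k → ℤ) (hn : n ≠ 0) :=
    mem_span_basisDiff_of_smul_mem (T : Set (Fin k × Fin k)) (v := v) hn
  refine (eventuallyPolynomial_ncard_vectorPartitions (rootHeight k) rootHeight_basisDiff_pos
    hsat hd a b).congr 0 fun t _ => ?_
  rw [kostant_intCast]

end TypeA

/-- `K(r(t))` with `r(t) = t(σ(λ)+τ(μ)−ν) + (σ(δ)+τ(δ)−2δ)` eventually agrees with a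
polynomial in `t` of degree at most `(k-1).choose 2`. -/
theorem stmt7 (k : ℕ) (hk : 0 < k)
    (lam mu ν : Fin k → ℕ) (hlam : Antitone lam) (hmu : Antitone mu) (hν : Antitone ν)
    (hsum : ∑ i, ν i = ∑ i, lam i + ∑ i, mu i)
    (σ τ : Equiv.Perm (Fin k)) :
    ∃ (N : ℤ) (p : Polynomial ℚ), p.natDegree ≤ (k - 1).choose 2 ∧
      ∀ t : ℤ, N ≤ t →
        (kostant k (fun i =>
            (t : ℚ) * ((lam (σ i) : ℚ) + (mu (τ i) : ℚ) - (ν i : ℚ)) +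
              (halfδ k (σ i) + halfδ k (τ i) - 2 * halfδ k i)) : ℚ) =
          p.eval (t : ℚ) := by
  have h := eventuallyPolynomial_kostant hk
    (fun i => (lam (σ i) : ℤ) + mu (τ i) - ν i)
    (fun i => 2 * (i : ℤ) - (σ i : ℕ) - (τ i : ℕ))
  refine h.congr 0 fun t _ => ?_
  congr 2
  ext i
  simp only [halfδ, Pi.add_apply, Pi.smul_apply, smul_eq_mul]
  push_cast
  ring
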